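/- For all k ≥ 1 and all homogeneous matrices X₁, …, X_{2k+1} ∈ gl(p,q): str(𝒫_{2k+1}(X₁,…,X_{2k+1})) = (2k+1) · str(𝒫_{2k}(X₁,…,X_{2k}) · X_{2k+1}). -/

import Mathlib

open Matrix

/-- Index type for the ℤ₂-graded space ℂ^p ⊕ ℂ^q. -/
abbrev Idx (p q : ℕ) := Sum (Fin p) (Fin q)

/-- Parity of a basis index. -/
def ipar {p q : ℕ} : Idx p q → ZMod 2
  | Sum.inl _ => 0
  | Sum.inr _ => 1

/-- `(-1)^a` for `a : ZMod 2`. -/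
noncomputable def sgn (a : ZMod 2) : ℂ := if a = 1 then -1 else 1

/-- A matrix is homogeneous of parity `ε` iff it maps the graded piece of
parity `a` into the piece of parity `a + ε`; equivalently, its entry `X i j`
vanishes unless `ipar i = ipar j + ε`. -/
def HasParity {p q : ℕ} (X : Matrix (Idx p q) (Idx p q) ℂ) (ε : ZMod 2) : Prop :=
  ∀ i j, ipar i ≠ ipar j + ε → X i j = 0

/-- A vector is homogeneous of parity `ε`. -/
def VHasParity {p q : ℕ} (u : Idx p q → ℂ) (ε : ZMod 2) : Prop :=
  ∀ i, ipar i ≠ ε → u i = 0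

/-- The super sign `ε(σ, 𝒳) = (-1)^{K(σ,𝒳)}`, where `K(σ,𝒳)` is the number of
pairs `(i,j)` with `i < j`, `σ i > σ j` and both `X (σ i)`, `X (σ j)` odd
(here only the parities `px` of the `X`'s matter). -/
noncomputable def superSign {k : ℕ} (σ : Equiv.Perm (Fin k)) (px : Fin k → ZMod 2) : ℂ :=
  (-1 : ℂ) ^ (Finset.univ.filter (fun ij : Fin k × Fin k =>
      ij.1 < ij.2 ∧ σ ij.2 < σ ij.1 ∧ px (σ ij.1) = 1 ∧ px (σ ij.2) = 1)).card

/-- The ordered matrix product `X (σ 0) * X (σ 1) * ⋯ * X (σ (k-1))`. -/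
noncomputable def permProd {k p q : ℕ} (σ : Equiv.Perm (Fin k))
    (X : Fin k → Matrix (Idx p q) (Idx p q) ℂ) : Matrix (Idx p q) (Idx p q) ℂ :=
  (List.ofFn fun i => X (σ i)).prod

/-- The standard supersymmetric super polynomial `𝒫_k`. -/
noncomputable def symPoly {k p q : ℕ} (X : Fin k → Matrix (Idx p q) (Idx p q) ℂ)
    (px : Fin k → ZMod 2) : Matrix (Idx p q) (Idx p q) ℂ :=
  ∑ σ : Equiv.Perm (Fin k), superSign σ px • permProd σ X

/-- The standard skew supersymmetric super polynomial `𝒜_k`. -/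
noncomputable def skewPoly {k p q : ℕ} (X : Fin k → Matrix (Idx p q) (Idx p q) ℂ)
    (px : Fin k → ZMod 2) : Matrix (Idx p q) (Idx p q) ℂ :=
  ∑ σ : Equiv.Perm (Fin k),
    (((Equiv.Perm.sign σ : ℤ) : ℂ) * superSign σ px) • permProd σ X

/-- The supertrace `str X = tr A - tr D` of a matrix in `gl(p,q)`. -/
noncomputable def strace {p q : ℕ} (X : Matrix (Idx p q) (Idx p q) ℂ) : ℂ :=
  ∑ i : Fin p, X (Sum.inl i) (Sum.inl i) - ∑ j : Fin q, X (Sum.inr j) (Sum.inr j)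

/-- The super bracket `[A,B] = AB - (-1)^{|A||B|} BA` of homogeneous matrices
`A`, `B` of parities `a`, `b`. -/
noncomputable def sbr {p q : ℕ} (A : Matrix (Idx p q) (Idx p q) ℂ) (a : ZMod 2)
    (B : Matrix (Idx p q) (Idx p q) ℂ) (b : ZMod 2) : Matrix (Idx p q) (Idx p q) ℂ :=
  A * B - sgn (a * b) • (B * A)

/-- The matrix of the even bilinear form `B` on `ℂ ⊕ ℂ^{2n}`: it is `1` on the
even line, `0` between the even and odd parts, and the standard symplectic form
with matrix `[[0, Iₙ],[-Iₙ, 0]]` on `ℂ^{2n}`. -/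
noncomputable def Bmat (n : ℕ) : Matrix (Idx 1 (2*n)) (Idx 1 (2*n)) ℂ :=
  fun i j => match i, j with
  | Sum.inl _, Sum.inl _ => 1
  | Sum.inl _, Sum.inr _ => 0
  | Sum.inr _, Sum.inl _ => 0
  | Sum.inr a, Sum.inr b =>
      if a.val + n = b.val then 1 else if b.val + n = a.val then -1 else 0

/-- The bilinear form `B(u,v)` on `ℂ ⊕ ℂ^{2n}`. -/
noncomputable def Bform (n : ℕ) (u v : Idx 1 (2*n) → ℂ) : ℂ :=
  ∑ i, ∑ j, u i * Bmat n i j * v j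

/-- `X` is a homogeneous element of `osp(1,2n)` of parity `ε`:
`B(Xu,v) + (-1)^{|X||u|} B(u,Xv) = 0` for all homogeneous `u`, `v`. -/
def ospMem {n : ℕ} (X : Matrix (Idx 1 (2*n)) (Idx 1 (2*n)) ℂ) (ε : ZMod 2) : Prop :=
  HasParity X ε ∧
  ∀ (u v : Idx 1 (2*n) → ℂ) (εu εv : ZMod 2), VHasParity u εu → VHasParity v εv →
    Bform n (X.mulVec u) v + sgn (ε * εu) * Bform n u (X.mulVec v) = 0

lemma sgn_zero : sgn 0 = 1 := by simp [sgn]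

lemma sgn_add (a b : ZMod 2) : sgn (a + b) = sgn a * sgn b := by
  have h : (1 : ZMod 2) + 1 = 0 := rfl
  have h' : ∀ x : ZMod 2, x = 0 ∨ x = 1 := by decide
  rcases h' a with rfl | rfl <;> rcases h' b with rfl | rfl <;> simp [sgn, h]

lemma sgn_mul_sum {m : ℕ} (a : ZMod 2) (f : Fin m → ZMod 2) :
    sgn (a * ∑ i, f i) = ∏ i, sgn (a * f i) := by
  induction m with
  | zero => simp [sgn_zero]
  | succ m ih => rw [Fin.sum_univ_succ, Fin.prod_univ_succ, mul_add, sgn_add, ih]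

lemma strace_eq_sum {p q : ℕ} (A : Matrix (Idx p q) (Idx p q) ℂ) :
    strace A = ∑ i, sgn (ipar i) * A i i := by
  simp [strace, Fintype.sum_sum_type, ipar, sgn, sub_eq_add_neg]

lemma strace_smul {p q : ℕ} (c : ℂ) (A : Matrix (Idx p q) (Idx p q) ℂ) :
    strace (c • A) = c * strace A := by
  simp only [strace_eq_sum, Matrix.smul_apply, smul_eq_mul, Finset.mul_sum]
  exact Finset.sum_congr rfl fun i _ => by ring

lemma strace_sum {p q : ℕ} {ι : Type*} (s : Finset ι)
    (A : ι → Matrix (Idx p q) (Idx p q) ℂ) :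
    strace (∑ i ∈ s, A i) = ∑ i ∈ s, strace (A i) := by
  simp only [strace_eq_sum, Matrix.sum_apply, Finset.mul_sum]
  exact Finset.sum_comm

/-- Graded cyclicity of the supertrace. -/
lemma strace_mul_comm {p q : ℕ} {A B : Matrix (Idx p q) (Idx p q) ℂ} {a b : ZMod 2}
    (hA : HasParity A a) (hB : HasParity B b) :
    strace (A * B) = sgn (a * b) * strace (B * A) := by
  simp only [strace_eq_sum, Matrix.mul_apply, Finset.mul_sum]
  rw [Finset.sum_comm]
  refine Finset.sum_congr rfl fun j _ => Finset.sum_congr rfl fun i _ => ?_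
  by_cases h₁ : ipar i = ipar j + a
  · by_cases h₂ : ipar j = ipar i + b
    · have h : sgn (ipar i) = sgn (a * b) * sgn (ipar j) := by
        rw [← sgn_add]
        have key : ∀ x y a b : ZMod 2, x = y + a → y = x + b → x = a * b + y := by decide
        rw [← key _ _ _ _ h₁ h₂]
      rw [h]
      ring
    · simp [hB j i h₂]
  · simp [hA i j h₁]

lemma HasParity.one {p q : ℕ} : HasParity (1 : Matrix (Idx p q) (Idx p q) ℂ) 0 := by
  intro i j h
  refine Matrix.one_apply_ne fun hij => h ?_
  simp [hij]

lemma HasParity.mul {p q : ℕ} {A B : Matrix (Idx p q) (Idx p q) ℂ} {a b : ZMod 2}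
    (hA : HasParity A a) (hB : HasParity B b) : HasParity (A * B) (a + b) := by
  intro i j h
  rw [Matrix.mul_apply]
  refine Finset.sum_eq_zero fun l _ => ?_
  by_cases h₁ : ipar i = ipar l + a
  · have h₂ : ipar l ≠ ipar j + b := fun h₂ => h (by rw [h₁, h₂]; ring)
    simp [hB l j h₂]
  · simp [hA i l h₁]

lemma HasParity.prod_ofFn {p q m : ℕ} {A : Fin m → Matrix (Idx p q) (Idx p q) ℂ}
    {a : Fin m → ZMod 2} (hA : ∀ i, HasParity (A i) (a i)) :
    HasParity (List.ofFn A).prod (∑ i, a i) := by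
  induction m with
  | zero => simpa using HasParity.one
  | succ m ih =>
    rw [List.ofFn_succ, List.prod_cons, Fin.sum_univ_succ]
    exact (hA 0).mul (ih fun i => hA i.succ)

/-- The sign contributed by `a` standing to the left of `b`. -/
noncomputable def pairSign {N : ℕ} (px : Fin N → ZMod 2) (a b : Fin N) : ℂ :=
  if b < a ∧ px a = 1 ∧ px b = 1 then -1 else 1

lemma pairSign_comm {N : ℕ} (px : Fin N → ZMod 2) {a b : Fin N} (h : a ≠ b) :
    pairSign px a b = sgn (px a * px b) * pairSign px b a := by
  have key : ∀ x y : ZMod 2, x * y = 1 ↔ x = 1 ∧ y = 1 := by decide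
  rcases lt_or_gt_of_ne h with h | h <;>
    by_cases ha : px a = 1 <;> by_cases hb : px b = 1 <;>
    simp [pairSign, sgn, key, h, h.not_gt, ha, hb]

/-- The super sign of an arbitrary word of indices. -/
noncomputable def wordSign {m N : ℕ} (px : Fin N → ZMod 2) (t : Fin m → Fin N) : ℂ :=
  ∏ i, ∏ j, if i < j then pairSign px (t i) (t j) else 1

lemma superSign_eq_wordSign {k : ℕ} (σ : Equiv.Perm (Fin k)) (px : Fin k → ZMod 2) :
    superSign σ px = wordSign px σ := by
  rw [superSign, wordSign, ← Finset.prod_const, Finset.prod_filter,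
    ← Finset.univ_product_univ, Finset.prod_product]
  refine Finset.prod_congr rfl fun i _ => Finset.prod_congr rfl fun j _ => ?_
  by_cases h : i < j <;> simp [h, pairSign]

lemma wordSign_cons {m N : ℕ} (px : Fin N → ZMod 2) (a : Fin N) (t : Fin m → Fin N) :
    wordSign px (Fin.cons a t : Fin (m + 1) → Fin N) =
      (∏ j, pairSign px a (t j)) * wordSign px t := by
  simp [wordSign, Fin.prod_univ_succ]

lemma wordSign_snoc {m N : ℕ} (px : Fin N → ZMod 2) (a : Fin N) (t : Fin m → Fin N) :
    wordSign px (Fin.snoc t a : Fin (m + 1) → Fin N) =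
      (∏ j, pairSign px (t j) a) * wordSign px t := by
  simp [wordSign, Fin.prod_univ_castSucc, Finset.prod_mul_distrib, mul_comm,
    Fin.castSucc_lt_last, (Fin.castSucc_lt_last _).not_gt]

lemma wordSign_castSucc {m N : ℕ} (px : Fin (N + 1) → ZMod 2) (t : Fin m → Fin N) :
    wordSign px (fun i => (t i).castSucc) = wordSign (fun i => px i.castSucc) t := by
  simp [wordSign, pairSign]

/-- The signed supertrace of the product of a word of matrices. -/
noncomputable def wordTrace {m N p q : ℕ} (X : Fin N → Matrix (Idx p q) (Idx p q) ℂ)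
    (px : Fin N → ZMod 2) (t : Fin m → Fin N) : ℂ :=
  wordSign px t * strace (List.ofFn fun i => X (t i)).prod

lemma strace_symPoly {k p q : ℕ} (X : Fin k → Matrix (Idx p q) (Idx p q) ℂ)
    (px : Fin k → ZMod 2) :
    strace (symPoly X px) = ∑ σ : Equiv.Perm (Fin k), wordTrace X px σ := by
  simp only [symPoly, strace_sum, strace_smul, superSign_eq_wordSign, permProd, wordTrace]

lemma wordTrace_cons {m N p q : ℕ} {X : Fin N → Matrix (Idx p q) (Idx p q) ℂ}
    {px : Fin N → ZMod 2} (hX : ∀ i, HasParity (X i) (px i)) {a : Fin N} {t : Fin m → Fin N}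
    (h : ∀ i, a ≠ t i) :
    wordTrace X px (Fin.cons a t : Fin (m + 1) → Fin N) =
      wordTrace X px (Fin.snoc t a : Fin (m + 1) → Fin N) := by
  have hs : ∏ j, pairSign px a (t j) =
      sgn (px a * ∑ j, px (t j)) * ∏ j, pairSign px (t j) a := by
    rw [sgn_mul_sum, ← Finset.prod_mul_distrib]
    exact Finset.prod_congr rfl fun j _ => pairSign_comm px (h j)
  have hsq : ∀ x : ZMod 2, sgn x * sgn x = 1 := fun x => by
    rw [← sgn_add, CharTwo.add_self_eq_zero, sgn_zero]
  have htr := strace_mul_comm (hX a) (HasParity.prod_ofFn fun j => hX (t j))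
  rw [wordTrace, wordTrace, wordSign_cons, wordSign_snoc, List.ofFn_succ, List.ofFn_succ']
  simp only [Fin.cons_zero, Fin.cons_succ, Fin.snoc_castSucc, Fin.snoc_last, List.prod_cons,
    List.concat_eq_append, List.prod_append, List.prod_nil, mul_one]
  rw [htr, hs]
  linear_combination ((∏ j, pairSign px (t j) a) * wordSign px t *
    strace ((List.ofFn fun i => X (t i)).prod * X a)) * hsq (px a * ∑ j, px (t j))

lemma finRotate_castSucc {n : ℕ} (i : Fin n) : finRotate (n + 1) i.castSucc = i.succ :=
  finRotate_of_lt i.isLt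

lemma wordTrace_mul_finRotate {n p q : ℕ} {X : Fin (n + 1) → Matrix (Idx p q) (Idx p q) ℂ}
    {px : Fin (n + 1) → ZMod 2} (hX : ∀ i, HasParity (X i) (px i))
    (σ : Equiv.Perm (Fin (n + 1))) :
    wordTrace X px (σ * finRotate (n + 1) : Equiv.Perm _) = wordTrace X px σ := by
  have h₁ : (σ : Fin (n + 1) → Fin (n + 1)) = Fin.cons (σ 0) fun i : Fin n => σ i.succ := by
    funext i
    cases i using Fin.cases <;> simp
  have h₂ : ((σ * finRotate (n + 1) : Equiv.Perm _) : Fin (n + 1) → Fin (n + 1)) =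
      Fin.snoc (fun i : Fin n => σ i.succ) (σ 0) := by
    funext i
    cases i using Fin.lastCases with
    | last => simp
    | cast i => simp
  rw [h₂, ← wordTrace_cons hX (fun i => σ.injective.ne (Fin.succ_ne_zero i).symm), ← h₁]

/-- The extension of a permutation of `Fin n` to `Fin (n + 1)` fixing the last point. -/
def extendLast {n : ℕ} (e : Equiv.Perm (Fin n)) : Equiv.Perm (Fin (n + 1)) :=
  finSuccEquivLast.symm.permCongr (Equiv.optionCongr e)

lemma coe_extendLast {n : ℕ} (e : Equiv.Perm (Fin n)) :
    (extendLast e : Fin (n + 1) → Fin (n + 1)) =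
      Fin.snoc (fun i => (e i).castSucc) (Fin.last n) := by
  funext i
  cases i using Fin.lastCases <;> simp [extendLast, Equiv.permCongr_apply]

lemma sum_perm_fixing_last {n : ℕ} (f : Equiv.Perm (Fin (n + 1)) → ℂ) :
    (∑ σ : Equiv.Perm (Fin (n + 1)), if σ (Fin.last n) = Fin.last n then f σ else 0) =
      ∑ e : Equiv.Perm (Fin n), f (extendLast e) := by
  rw [← (finSuccEquivLast.symm.permCongr).sum_comp,
    ← Equiv.Perm.decomposeOption.symm.sum_comp, Fintype.sum_prod_type, Fintype.sum_option]
  simp [Equiv.permCongr_apply, extendLast]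
  rfl

lemma wordTrace_extendLast {n p q : ℕ} (X : Fin (n + 1) → Matrix (Idx p q) (Idx p q) ℂ)
    (px : Fin (n + 1) → ZMod 2) (e : Equiv.Perm (Fin n)) :
    wordTrace X px (extendLast e) =
      superSign e (fun i => px i.castSucc) *
        strace (permProd e (fun i => X i.castSucc) * X (Fin.last n)) := by
  have h : ∀ i : Fin n, pairSign px (e i).castSucc (Fin.last n) = 1 := fun i => by
    simp [pairSign, (Fin.castSucc_lt_last _).not_gt]
  rw [wordTrace, coe_extendLast, wordSign_snoc, wordSign_castSucc, superSign_eq_wordSign,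
    List.ofFn_succ', permProd]
  simp [h]

/-- The general form of the recursion, valid for any number of homogeneous matrices. -/
lemma strace_symPoly_succ {n p q : ℕ} {X : Fin (n + 1) → Matrix (Idx p q) (Idx p q) ℂ}
    {px : Fin (n + 1) → ZMod 2} (hX : ∀ i, HasParity (X i) (px i)) :
    strace (symPoly X px) = (n + 1 : ℂ) * strace
      (symPoly (fun i : Fin n => X i.castSucc) (fun i => px i.castSucc) * X (Fin.last n)) := by
  set G : Fin (n + 1) → ℂ := fun j => ∑ σ : Equiv.Perm (Fin (n + 1)),
    if σ j = Fin.last n then wordTrace X px σ else 0 with hG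
  have hsum : strace (symPoly X px) = ∑ j, G j := by
    rw [strace_symPoly, hG, Finset.sum_comm]
    refine Finset.sum_congr rfl fun σ _ => ?_
    simp [← Equiv.eq_symm_apply]
  have hrot : ∀ j, G (finRotate (n + 1) j) = G j := fun j => by
    refine Fintype.sum_equiv (Equiv.mulRight (finRotate (n + 1))) _ _ fun σ => ?_
    simp only [Equiv.coe_mulRight, wordTrace_mul_finRotate hX, Equiv.Perm.mul_apply]
  have hconst : ∀ j, G j = G 0 := fun j => by
    induction j using Fin.induction with
    | zero => rfl
    | succ j ih => rw [← finRotate_castSucc, hrot, ih]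
  have hlast : G (Fin.last n) = strace
      (symPoly (fun i : Fin n => X i.castSucc) (fun i => px i.castSucc) * X (Fin.last n)) := by
    refine (sum_perm_fixing_last _).trans ?_
    simp only [wordTrace_extendLast, symPoly, Finset.sum_mul, strace_sum, Matrix.smul_mul,
      strace_smul]
  rw [hsum, ← hlast, hconst (Fin.last n), Finset.sum_congr rfl fun j _ => hconst j]
  simp

/-- `str (𝒫_{2k+1}(X₁,…,X_{2k+1})) = (2k+1) ⋅ str (𝒫_{2k}(X₁,…,X_{2k}) ⬝ X_{2k+1})`. -/
theorem strace_symPoly_odd (p q k : ℕ) (hk : 1 ≤ k)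
    (X : Fin (2*k+1) → Matrix (Idx p q) (Idx p q) ℂ)
    (px : Fin (2*k+1) → ZMod 2) (hX : ∀ i, HasParity (X i) (px i)) :
    strace (symPoly X px) =
      (2*k+1 : ℂ) * strace
        (symPoly (fun i : Fin (2*k) => X i.castSucc) (fun i => px i.castSucc)
          * X (Fin.last (2*k))) := by
  have h := strace_symPoly_succ hX
  push_cast at h
  exact h
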